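/- Let r ≥ 1 and let v_0 < v_1 < … < v_r be r+1 points in a nontrivial interval I. There exists no r-nondecreasing function f on I satisfying f(v_i) > 0 for every i with the same parity as r+1 and f(v_i) ≤ 0 for every i of the opposite parity; and there exists no r-nonincreasing function f on I satisfying f(v_i) ≤ 0 for every i with the same parity as r+1 and f(v_i) > 0 for every i of the opposite parity. -/

import Mathlib

/-- The `(r+1)×(r+1)` matrix whose `i`-th row is `(1, vᵢ, vᵢ², …, vᵢ^{r−1}, f(vᵢ))`. -/
noncomputable def Lmat (r : ℕ) (v : Fin (r + 1) → ℝ) (f : ℝ → ℝ) :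
    Matrix (Fin (r + 1)) (Fin (r + 1)) ℝ :=
  fun i j => if (j : ℕ) < r then v i ^ (j : ℕ) else f (v i)

/-- `f` is `r`-nondecreasing on `I`: for all `v₀ < v₁ < … < v_r` in `I`, the
determinant `L_v(f)` is nonnegative. -/
def RNondecreasingOn (r : ℕ) (f : ℝ → ℝ) (I : Set ℝ) : Prop :=
  ∀ v : Fin (r + 1) → ℝ, (∀ i, v i ∈ I) → StrictMono v → 0 ≤ (Lmat r v f).det

/-- `f` is `r`-nonincreasing on `I` if `−f` is `r`-nondecreasing on `I`. -/
def RNonincreasingOn (r : ℕ) (f : ℝ → ℝ) (I : Set ℝ) : Prop :=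
  RNondecreasingOn r (fun y => -f y) I

theorem det_vandermonde_pos_of_strictMono {n : ℕ} {v : Fin n → ℝ} (hv : StrictMono v) :
    0 < (Matrix.vandermonde v).det := by
  rw [Matrix.det_vandermonde]
  exact Finset.prod_pos fun i _ => Finset.prod_pos fun j hj =>
    sub_pos.2 (hv (Finset.mem_Ioi.1 hj))

/-- Expansion of `L_v(f)` along its last column. -/
theorem Lmat_det_eq_sum (r : ℕ) (v : Fin (r + 1) → ℝ) (f : ℝ → ℝ) :
    (Lmat r v f).det = ∑ i : Fin (r + 1),
      (-1) ^ ((i : ℕ) + r) * f (v i) * (Matrix.vandermonde (v ∘ i.succAbove)).det := by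
  rw [Matrix.det_succ_column _ (Fin.last r)]
  refine Finset.sum_congr rfl fun i _ => ?_
  have hminor : (Lmat r v f).submatrix i.succAbove (Fin.last r).succAbove =
      Matrix.vandermonde (v ∘ i.succAbove) := by
    ext a b
    simp [Lmat, Matrix.vandermonde_apply]
  rw [hminor]
  simp [Lmat]

theorem Lmat_det_neg {r : ℕ} {v : Fin (r + 1) → ℝ} (hmono : StrictMono v) {f : ℝ → ℝ}
    (hle : ∀ i : Fin (r + 1), (-1) ^ ((i : ℕ) + r) * f (v i) ≤ 0)
    (hlt : ∃ i : Fin (r + 1), (-1) ^ ((i : ℕ) + r) * f (v i) < 0) :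
    (Lmat r v f).det < 0 := by
  have hpos (i : Fin (r + 1)) : 0 < (Matrix.vandermonde (v ∘ i.succAbove)).det :=
    det_vandermonde_pos_of_strictMono (hmono.comp (Fin.strictMono_succAbove i))
  obtain ⟨k, hk⟩ := hlt
  rw [Lmat_det_eq_sum]
  exact Finset.sum_neg' (fun i _ => mul_nonpos_of_nonpos_of_nonneg (hle i) (hpos i).le)
    ⟨k, Finset.mem_univ k, mul_neg_of_neg_of_pos hk (hpos k)⟩

theorem neg_one_pow_add_of_mod_eq {i r : ℕ} (h : i % 2 = (r + 1) % 2) :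
    (-1 : ℝ) ^ (i + r) = -1 :=
  Odd.neg_one_pow (Nat.odd_iff.2 (by omega))

theorem neg_one_pow_add_of_mod_ne {i r : ℕ} (h : i % 2 ≠ (r + 1) % 2) :
    (-1 : ℝ) ^ (i + r) = 1 :=
  Even.neg_one_pow (Nat.even_iff.2 (by omega))

/-- Lemma, sign-pattern exclusion: for points `v₀ < … < v_r` in a
nontrivial interval `I`, no `r`-nondecreasing function on `I` can satisfy `f(vᵢ) > 0`
for all `i ≡ r+1 (mod 2)` and `f(vᵢ) ≤ 0` otherwise; and no `r`-nonincreasing function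
on `I` can satisfy `f(vᵢ) ≤ 0` for all `i ≡ r+1 (mod 2)` and `f(vᵢ) > 0` otherwise. -/
theorem stmt17 (r : ℕ) (hr : 1 ≤ r) (I : Set ℝ) (hI : I.OrdConnected) (hInt : I.Nontrivial)
    (v : Fin (r + 1) → ℝ) (hv : ∀ i, v i ∈ I) (hmono : StrictMono v) :
    (¬ ∃ f : ℝ → ℝ, RNondecreasingOn r f I ∧
        (∀ i : Fin (r + 1), (i : ℕ) % 2 = (r + 1) % 2 → 0 < f (v i)) ∧
        (∀ i : Fin (r + 1), (i : ℕ) % 2 ≠ (r + 1) % 2 → f (v i) ≤ 0)) ∧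
    (¬ ∃ f : ℝ → ℝ, RNonincreasingOn r f I ∧
        (∀ i : Fin (r + 1), (i : ℕ) % 2 = (r + 1) % 2 → f (v i) ≤ 0) ∧
        (∀ i : Fin (r + 1), (i : ℕ) % 2 ≠ (r + 1) % 2 → 0 < f (v i))) := by
  constructor
  · rintro ⟨f, hf, hpos, hnonpos⟩
    refine (hf v hv hmono).not_gt (Lmat_det_neg hmono (fun i => ?_) ⟨⟨r - 1, by omega⟩, ?_⟩)
    · by_cases h : (i : ℕ) % 2 = (r + 1) % 2
      · rw [neg_one_pow_add_of_mod_eq h]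
        linarith [hpos i h]
      · rw [neg_one_pow_add_of_mod_ne h]
        linarith [hnonpos i h]
    · have h : (r - 1) % 2 = (r + 1) % 2 := by omega
      rw [neg_one_pow_add_of_mod_eq h]
      linarith [hpos ⟨r - 1, by omega⟩ h]
  · rintro ⟨f, hf, hnonpos, hpos⟩
    refine (hf v hv hmono).not_gt (Lmat_det_neg hmono (fun i => ?_) ⟨Fin.last r, ?_⟩)
    · by_cases h : (i : ℕ) % 2 = (r + 1) % 2
      · rw [neg_one_pow_add_of_mod_eq h]
        linarith [hnonpos i h]
      · rw [neg_one_pow_add_of_mod_ne h]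
        linarith [hpos i h]
    · have h : ((Fin.last r : Fin (r + 1)) : ℕ) % 2 ≠ (r + 1) % 2 := by
        rw [Fin.val_last]
        omega
      rw [neg_one_pow_add_of_mod_ne h]
      linarith [hpos (Fin.last r) h]
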